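/- Let N ≥ 2, n ≥ 1, and for k = 1,…,N let 1 ≤ q_k < p_k < ∞ with 1/p = 1/p_1+⋯+1/p_N. If α_1, α_2 ∈ ℝ satisfy α_1/p_1 + α_2/p_2 > -n/p and α_k < n(p_k/q_k - 1) for k = 1, 2, then the tuple of weights (w_1, w_2, w_3, …, w_N) = (|x|^{α_1}, |x|^{α_2}, 1, …, 1) belongs to the class A_{P⃗/Q⃗}, where P⃗ = (p_1,…,p_N) and Q⃗ = (q_1,…,q_N). -/

import Mathlib

open MeasureTheory
open scoped BigOperators

noncomputable section

/-- The axis-parallel cube with lower corner `c` and side length `h` in `ℝⁿ`. -/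
def cube (n : ℕ) (c : Fin n → ℝ) (h : ℝ) : Set (EuclideanSpace ℝ (Fin n)) :=
  {x | ∀ i, c i ≤ x i ∧ x i ≤ c i + h}

/-- The class `A_{P⃗/Q⃗}` for `P⃗ = (p₁,…,p_N)`, `Q⃗ = (q₁,…,q_N)` and combined exponent `p`
with `1/p = Σ 1/p_k`: membership of `(w₁,…,w_N)` means
`sup_Q (|Q|⁻¹ ∫_Q ν_w)^{1/p} Π_k (|Q|⁻¹ ∫_Q w_k^{1-(p_k/q_k)'})^{1/q_k - 1/p_k} < ∞`,
where `ν_w = Π_k w_k^{p/p_k}` and `(p_k/q_k)' = (p_k/q_k)/((p_k/q_k) - 1)`. -/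
def IsMultiApq (n N : ℕ) (p : ℝ) (pk qk : Fin N → ℝ)
    (w : Fin N → EuclideanSpace ℝ (Fin n) → ℝ) : Prop :=
  ∃ A : ℝ, ∀ (c : Fin n → ℝ) (h : ℝ), 0 < h →
    ((h ^ n)⁻¹ * ∫ x in cube n c h, ∏ k, w k x ^ (p / pk k)) ^ (1 / p) *
      ∏ k, ((h ^ n)⁻¹ *
        ∫ x in cube n c h,
          w k x ^ (1 - (pk k / qk k) / (pk k / qk k - 1))) ^ (1 / qk k - 1 / pk k) ≤ A

theorem Real.rpow_le_rpow_abs_mul_rpow {L R t : ℝ} (β : ℝ) (hL : 1 ≤ L) (hR : 0 < R) (ht : 0 < t)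
    (hRt : R ≤ L * t) (htR : t ≤ L * R) : t ^ β ≤ L ^ |β| * R ^ β := by
  have hL0 : 0 < L := by linarith
  rcases le_or_gt 0 β with hβ | hβ
  · rw [abs_of_nonneg hβ, ← Real.mul_rpow hL0.le hR.le]
    exact Real.rpow_le_rpow ht.le htR hβ
  · have h : t ^ β ≤ (R / L) ^ β :=
      Real.rpow_le_rpow_of_nonpos (by positivity) ((div_le_iff₀' hL0).2 hRt) hβ.le
    rwa [Real.div_rpow hR.le hL0.le, div_eq_inv_mul, ← Real.rpow_neg hL0.le,
      ← abs_of_neg hβ] at h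

theorem integrableOn_norm_rpow_ball {n : ℕ} (hn : 1 ≤ n) {β : ℝ} (hβ : -(n : ℝ) < β) (r : ℝ) :
    IntegrableOn (fun x : EuclideanSpace ℝ (Fin n) => ‖x‖ ^ β) (Metric.ball 0 r) := by
  have : Nonempty (Fin n) := ⟨⟨0, hn⟩⟩
  rcases le_or_gt r 0 with hr | hr
  · simp [Metric.ball_eq_empty.2 hr]
  rw [integrableOn_fun_norm_addHaar volume (f := fun y : ℝ => y ^ β), finrank_euclideanSpace_fin]
  have h := (intervalIntegral.integrableOn_Ioo_rpow_iff (s := (n : ℝ) - 1 + β) hr).2 (by linarith)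
  refine h.congr_fun (fun y hy => ?_) measurableSet_Ioo
  simp only [smul_eq_mul]
  rw [Real.rpow_add hy.1, ← Real.rpow_natCast, Nat.cast_sub hn, Nat.cast_one]

theorem setIntegral_norm_rpow_ball {n : ℕ} (β : ℝ) {r : ℝ} (hr : 0 < r) :
    ∫ x in Metric.ball (0 : EuclideanSpace ℝ (Fin n)) r, ‖x‖ ^ β =
      r ^ n * r ^ β * ∫ x in Metric.ball (0 : EuclideanSpace ℝ (Fin n)) 1, ‖x‖ ^ β := by
  have h := Measure.setIntegral_comp_smul_of_pos (volume : Measure (EuclideanSpace ℝ (Fin n)))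
    (fun x => ‖x‖ ^ β) (Metric.ball 0 1) hr
  rw [smul_unitBall_of_pos hr, finrank_euclideanSpace_fin, smul_eq_mul,
    eq_inv_mul_iff_mul_eq₀ (by positivity)] at h
  simp only [norm_smul, Real.norm_of_nonneg hr.le, Real.mul_rpow hr.le (norm_nonneg _)] at h
  rw [← h, integral_const_mul, mul_assoc]

theorem cube_eq_preimage_Icc (n : ℕ) (c : Fin n → ℝ) (h : ℝ) :
    cube n c h = WithLp.ofLp ⁻¹' Set.Icc c (fun i => c i + h) := by
  ext x
  simp [cube, Set.mem_Icc, Pi.le_def, forall_and]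

theorem measurableSet_cube (n : ℕ) (c : Fin n → ℝ) (h : ℝ) : MeasurableSet (cube n c h) := by
  rw [cube_eq_preimage_Icc]
  exact (PiLp.volume_preserving_ofLp (Fin n)).measurable measurableSet_Icc

theorem volume_cube (n : ℕ) (c : Fin n → ℝ) {h : ℝ} (hh : 0 ≤ h) :
    volume (cube n c h) = ENNReal.ofReal (h ^ n) := by
  rw [cube_eq_preimage_Icc, (PiLp.volume_preserving_ofLp (Fin n)).measure_preimage
    measurableSet_Icc.nullMeasurableSet, Real.volume_Icc_pi]
  simp [ENNReal.ofReal_pow hh]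

theorem norm_sub_corner_le_of_mem_cube {n : ℕ} {c : Fin n → ℝ} {h : ℝ} (hh : 0 ≤ h)
    {x : EuclideanSpace ℝ (Fin n)} (hx : x ∈ cube n c h) : ‖x - WithLp.toLp 2 c‖ ≤ n * h := by
  rcases Nat.eq_zero_or_pos n with rfl | hn
  · simp [EuclideanSpace.norm_eq]
  have hn' : (1 : ℝ) ≤ n := by exact_mod_cast hn
  refine (sq_le_sq₀ (norm_nonneg _) (by positivity)).1 ?_
  rw [EuclideanSpace.norm_sq_eq]
  calc ∑ i, ‖(x - WithLp.toLp 2 c) i‖ ^ 2 ≤ ∑ _i : Fin n, h ^ 2 := by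
        refine Finset.sum_le_sum fun i _ => ?_
        rw [Real.norm_eq_abs, sq_abs]
        have := hx i
        have h1 : (x - WithLp.toLp 2 c) i = x i - c i := rfl
        rw [h1]
        nlinarith
    _ = n * h ^ 2 := by simp
    _ ≤ (n * h) ^ 2 := by nlinarith [sq_nonneg h, mul_nonneg (sub_nonneg.2 hn') (sq_nonneg h)]

/-- The average of `‖x‖ ^ β` over a cube is at most a constant times `(h + ‖c‖) ^ β`. -/
theorem exists_average_norm_rpow_le {n : ℕ} (hn : 1 ≤ n) {β : ℝ} (hβ : -(n : ℝ) < β) :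
    ∃ C : ℝ, 0 ≤ C ∧ ∀ (c : Fin n → ℝ) (h : ℝ), 0 < h →
      (h ^ n)⁻¹ * ∫ x in cube n c h, ‖x‖ ^ β ≤
        C * (h + ‖(WithLp.toLp 2 c : EuclideanSpace ℝ (Fin n))‖) ^ β := by
  set K := ∫ x in Metric.ball (0 : EuclideanSpace ℝ (Fin n)) 1, ‖x‖ ^ β with hK
  have hK0 : 0 ≤ K := integral_nonneg fun x => Real.rpow_nonneg (norm_nonneg x) β
  have hn' : (1 : ℝ) ≤ n := by exact_mod_cast hn
  set L : ℝ := 3 * n with hL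
  have hL1 : 1 ≤ L := by linarith
  have hL0 : 0 < L := by linarith
  refine ⟨L ^ |β| * (L ^ n * K + 1), by positivity, fun c h hh => ?_⟩
  set v : EuclideanSpace ℝ (Fin n) := WithLp.toLp 2 c with hv
  have hR : 0 < h + ‖v‖ := by positivity
  have hnh : h ≤ n * h := by nlinarith
  have hRβ : 0 ≤ L ^ |β| * (h + ‖v‖) ^ β := by positivity
  rw [inv_mul_le_iff₀ (by positivity)]
  rcases le_or_gt (2 * n * h) ‖v‖ with hfar | hnear
  · have hpt : ∀ x ∈ cube n c h, ‖‖x‖ ^ β‖ ≤ L ^ |β| * (h + ‖v‖) ^ β := by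
      intro x hx
      have hxv := norm_sub_corner_le_of_mem_cube hh.le hx
      rw [← hv] at hxv
      have h1 : ‖v‖ ≤ ‖x‖ + ‖x - v‖ := by
        simpa [norm_sub_rev] using norm_sub_le x (x - v)
      have h2 : ‖x‖ ≤ ‖v‖ + ‖x - v‖ := by
        simpa using norm_add_le v (x - v)
      have hx0 : 0 < ‖x‖ := by nlinarith
      rw [Real.norm_of_nonneg (Real.rpow_nonneg (norm_nonneg x) β)]
      exact Real.rpow_le_rpow_abs_mul_rpow β hL1 hR hx0 (by nlinarith) (by nlinarith)
    have hvol := volume_cube n c hh.le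
    have hint := norm_setIntegral_le_of_norm_le_const (hvol ▸ ENNReal.ofReal_lt_top) hpt
    rw [Measure.real, hvol, ENNReal.toReal_ofReal (by positivity)] at hint
    calc ∫ x in cube n c h, ‖x‖ ^ β ≤ L ^ |β| * (h + ‖v‖) ^ β * h ^ n :=
          (Real.le_norm_self _).trans hint
      _ ≤ L ^ |β| * (h + ‖v‖) ^ β * h ^ n * (L ^ n * K + 1) :=
          le_mul_of_one_le_right (by positivity) (by linarith [mul_nonneg (pow_pos hL0 n).le hK0])
      _ = _ := by ring
  · have hr : 0 < L * h := by positivity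
    have hsub : cube n c h ⊆ Metric.ball 0 (L * h) := by
      intro x hx
      have hxv := norm_sub_corner_le_of_mem_cube hh.le hx
      rw [← hv] at hxv
      have h2 : ‖x‖ ≤ ‖v‖ + ‖x - v‖ := by
        simpa using norm_add_le v (x - v)
      rw [mem_ball_zero_iff]
      linarith
    have hcmp : (L * h) ^ β ≤ L ^ |β| * (h + ‖v‖) ^ β :=
      Real.rpow_le_rpow_abs_mul_rpow β hL1 hR hr (by nlinarith)
        (mul_le_mul_of_nonneg_left (by linarith [norm_nonneg v]) hL0.le)
    calc ∫ x in cube n c h, ‖x‖ ^ β ≤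
          ∫ x in Metric.ball (0 : EuclideanSpace ℝ (Fin n)) (L * h), ‖x‖ ^ β :=
          setIntegral_mono_set (integrableOn_norm_rpow_ball hn hβ _)
            (Filter.Eventually.of_forall fun x => Real.rpow_nonneg (norm_nonneg x) β)
            hsub.eventuallyLE
      _ = (L * h) ^ n * K * (L * h) ^ β := by rw [setIntegral_norm_rpow_ball β hr]; ring
      _ ≤ (L * h) ^ n * K * (L ^ |β| * (h + ‖v‖) ^ β) :=
          mul_le_mul_of_nonneg_left hcmp (by positivity)
      _ = h ^ n * ((L ^ n * K) * (L ^ |β| * (h + ‖v‖) ^ β)) := by rw [mul_pow]; ring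
      _ ≤ h ^ n * ((L ^ n * K + 1) * (L ^ |β| * (h + ‖v‖) ^ β)) := by gcongr; linarith
      _ = _ := by ring

/-- A tuple of power weights belongs to `A_{P⃗/Q⃗}` as soon as the powers of the norm that occur
in its characteristic are locally integrable. -/
theorem isMultiApq_norm_rpow {n N : ℕ} (hn : 1 ≤ n) {p : ℝ} (hp : 0 < p) {pk qk : Fin N → ℝ}
    (hqk : ∀ k, 0 < qk k) (hqp : ∀ k, qk k < pk k) {a : Fin N → ℝ}
    (ha : -(n : ℝ) / p < ∑ k, a k / pk k) (hak : ∀ k, a k < n * (pk k / qk k - 1)) :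
    IsMultiApq n N p pk qk (fun k x => ‖x‖ ^ a k) := by
  have : Nonempty (Fin n) := ⟨⟨0, hn⟩⟩
  have hr : ∀ k, 0 < pk k / qk k - 1 := fun k => sub_pos.2 ((one_lt_div (hqk k)).2 (hqp k))
  have hpk : ∀ k, 0 < pk k := fun k => (hqk k).trans (hqp k)
  have hpow : ∀ (k : Fin N) (x : EuclideanSpace ℝ (Fin n)),
      (‖x‖ ^ a k) ^ (1 - (pk k / qk k) / (pk k / qk k - 1)) =
        ‖x‖ ^ (-a k / (pk k / qk k - 1)) := by
    intro k x
    rw [← Real.rpow_mul (norm_nonneg x)]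
    congr 1
    have := (hr k).ne'
    field_simp
    ring
  have hprod : ∀ c h, ∫ x in cube n c h, ∏ k, (‖x‖ ^ a k) ^ (p / pk k) =
      ∫ x in cube n c h, ‖x‖ ^ (p * ∑ k, a k / pk k) := by
    intro c h
    refine integral_congr_ae (ae_restrict_of_ae ?_)
    filter_upwards [Measure.ae_ne volume (0 : EuclideanSpace ℝ (Fin n))] with x hx
    rw [Finset.mul_sum, Real.rpow_sum_of_pos (norm_pos_iff.2 hx)]
    refine Finset.prod_congr rfl fun k _ => ?_
    rw [← Real.rpow_mul (norm_nonneg x)]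
    congr 1
    ring
  obtain ⟨C₀, hC₀, hν⟩ := exists_average_norm_rpow_le hn (β := p * ∑ k, a k / pk k)
    (by rwa [div_lt_iff₀' hp] at ha)
  choose C hC hw using fun k => exists_average_norm_rpow_le hn
    (β := -a k / (pk k / qk k - 1)) (by rw [lt_div_iff₀ (hr k)]; linarith [hak k])
  refine ⟨C₀ ^ (1 / p) * ∏ k, C k ^ (1 / qk k - 1 / pk k), fun c h hh => ?_⟩
  have hR : 0 < h + ‖(WithLp.toLp 2 c : EuclideanSpace ℝ (Fin n))‖ := by positivity
  set R := h + ‖(WithLp.toLp 2 c : EuclideanSpace ℝ (Fin n))‖ with hRdef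
  have havg : ∀ β : ℝ, 0 ≤ (h ^ n)⁻¹ * ∫ x in cube n c h, ‖x‖ ^ β := fun β =>
    mul_nonneg (by positivity) (integral_nonneg fun x => Real.rpow_nonneg (norm_nonneg x) β)
  have hexp : ∀ k, 0 ≤ 1 / qk k - 1 / pk k := fun k =>
    sub_nonneg.2 (one_div_le_one_div_of_le (hqk k) (hqp k).le)
  simp only [hpow, hprod]
  have hbound : ((h ^ n)⁻¹ * ∫ x in cube n c h, ‖x‖ ^ (p * ∑ k, a k / pk k)) ^ (1 / p) ≤
      C₀ ^ (1 / p) * R ^ (∑ k, a k / pk k) := by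
    refine (Real.rpow_le_rpow (havg _) (hν c h hh) (by positivity)).trans_eq ?_
    rw [Real.mul_rpow hC₀ (Real.rpow_nonneg hR.le _), ← Real.rpow_mul hR.le]
    congr 2
    field_simp
  have hboundk : ∀ k, ((h ^ n)⁻¹ * ∫ x in cube n c h, ‖x‖ ^ (-a k / (pk k / qk k - 1))) ^
      (1 / qk k - 1 / pk k) ≤ C k ^ (1 / qk k - 1 / pk k) * R ^ (-(a k / pk k)) := by
    intro k
    refine (Real.rpow_le_rpow (havg _) (hw k c h hh) (hexp k)).trans_eq ?_
    rw [Real.mul_rpow (hC k) (Real.rpow_nonneg hR.le _), ← Real.rpow_mul hR.le]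
    congr 2
    have h1 := (hr k).ne'
    have h2 := (hpk k).ne'
    have h3 := (hqk k).ne'
    have h4 : 1 / qk k - 1 / pk k = (pk k / qk k - 1) / pk k := by field_simp
    rw [h4, div_mul_div_cancel₀ h1, neg_div]
  refine (mul_le_mul hbound (Finset.prod_le_prod (fun k _ => Real.rpow_nonneg (havg _) _)
    fun k _ => hboundk k) (Finset.prod_nonneg fun k _ => Real.rpow_nonneg (havg _) _)
    (by positivity)).trans_eq ?_
  rw [Finset.prod_mul_distrib, ← Real.rpow_sum_of_pos hR, Finset.sum_neg_distrib,
    Real.rpow_neg hR.le]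
  have := (Real.rpow_pos_of_pos hR (∑ k, a k / pk k)).ne'
  field_simp

/-- Let `N ≥ 2`, `n ≥ 1`, `1 ≤ q_k < p_k < ∞` and
`1/p = 1/p₁ + ⋯ + 1/p_N`.  If `α₁/p₁ + α₂/p₂ > -n/p` and `α_k < n(p_k/q_k - 1)` for
`k = 1, 2`, then `(|x|^{α₁}, |x|^{α₂}, 1, …, 1) ∈ A_{P⃗/Q⃗}`. -/
theorem stmt_17 (N n : ℕ) (hN : 2 ≤ N) (hn : 1 ≤ n) (p : ℝ) (pk qk : Fin N → ℝ)
    (hqk : ∀ k, 1 ≤ qk k) (hqp : ∀ k, qk k < pk k) (hp : 1 / p = ∑ k, 1 / pk k)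
    (α₁ α₂ : ℝ)
    (hα : -(n : ℝ) / p < α₁ / pk ⟨0, by omega⟩ + α₂ / pk ⟨1, by omega⟩)
    (hα₁ : α₁ < n * (pk ⟨0, by omega⟩ / qk ⟨0, by omega⟩ - 1))
    (hα₂ : α₂ < n * (pk ⟨1, by omega⟩ / qk ⟨1, by omega⟩ - 1)) :
    IsMultiApq n N p pk qk
      (fun k x => if (k : ℕ) = 0 then ‖x‖ ^ α₁ else if (k : ℕ) = 1 then ‖x‖ ^ α₂ else 1) := by
  have hpk : ∀ k, 0 < pk k := fun k => by linarith [hqk k, hqp k]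
  have hp0 : 0 < p := by
    rw [← one_div_pos, hp]
    exact Finset.sum_pos (fun k _ => one_div_pos.2 (hpk k)) ⟨⟨0, by omega⟩, Finset.mem_univ _⟩
  set a : Fin N → ℝ := fun k => if (k : ℕ) = 0 then α₁ else if (k : ℕ) = 1 then α₂ else 0 with ha
  have hw : (fun (k : Fin N) (x : EuclideanSpace ℝ (Fin n)) =>
      if (k : ℕ) = 0 then ‖x‖ ^ α₁ else if (k : ℕ) = 1 then ‖x‖ ^ α₂ else 1) =
      fun k x => ‖x‖ ^ a k := by
    funext k x
    simp only [ha]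
    split_ifs <;> simp
  have hsum : ∑ k, a k / pk k = α₁ / pk ⟨0, by omega⟩ + α₂ / pk ⟨1, by omega⟩ := by
    rw [Finset.sum_eq_add (⟨0, by omega⟩ : Fin N) ⟨1, by omega⟩ (by simp) _ (by simp) (by simp)]
    · simp [ha]
    · rintro ⟨k, hk⟩ - ⟨h0, h1⟩
      simp only [ne_eq, Fin.mk.injEq] at h0 h1
      simp [ha, h0, h1]
  rw [hw]
  refine isMultiApq_norm_rpow hn hp0 (fun k => by linarith [hqk k]) hqp (hsum ▸ hα) ?_
  rintro ⟨k, hk⟩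
  rcases k with _ | _ | k
  · simpa [ha] using hα₁
  · simpa [ha] using hα₂
  · have hq : 0 < qk ⟨k + 2, hk⟩ := by linarith [hqk ⟨k + 2, hk⟩]
    have := sub_pos.2 ((one_lt_div hq).2 (hqp ⟨k + 2, hk⟩))
    have hn0 : (0 : ℝ) < n := by exact_mod_cast hn
    simpa [ha] using mul_pos hn0 this

end
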